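/- For every integer A ≥ 2, positive reals α₁, …, α_A with Ā = Σⱼ αⱼ, and indices i ≠ k in {1,…,A}: ∫_{T_A} (πᵢ(x) log πᵢ(x)) (πₖ(x) log πₖ(x)) ∏ⱼ πⱼ(x)^{αⱼ−1} dx = (∏ⱼ Γ(αⱼ)/Γ(Ā)) · (αᵢ αₖ / ((Ā+1) Ā)) · [ (ψ₀(αᵢ+1) − ψ₀(Ā+2))(ψ₀(αₖ+1) − ψ₀(Ā+2)) − ψ₁(Ā+2) ]. -/

import Mathlib

open MeasureTheory Real Finset

/-- The digamma function `ψ₀(x) = d/dx log Γ(x)`. -/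
noncomputable def digamma (x : ℝ) : ℝ := deriv (fun y => Real.log (Real.Gamma y)) x

/-- The trigamma function `ψ₁ = ψ₀′`. -/
noncomputable def trigamma (x : ℝ) : ℝ := deriv digamma x

/-- The simplex coordinates: for `x ∈ ℝ^{A−1}`, `π i x = x i` for `i < A − 1` and
`π (A-1) x = 1 − ∑ x j`. -/
noncomputable def simplexCoord (A : ℕ) (x : Fin (A - 1) → ℝ) (i : Fin A) : ℝ :=
  if h : (i : ℕ) < A - 1 then x ⟨i, h⟩ else 1 - ∑ j, x j

/-- The solid simplex `T_A = {x ∈ ℝ^{A−1} : xᵢ ≥ 0, ∑ xᵢ ≤ 1}`. -/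
def solidSimplex (A : ℕ) : Set (Fin (A - 1) → ℝ) :=
  {x | (∀ i, 0 ≤ x i) ∧ ∑ i, x i ≤ 1}

open scoped ENNReal
open ProbabilityTheory (beta)

/-- The power kernel `x ↦ x ^ (a - 1)` on the positive half-line, extended by zero. -/
noncomputable def powKernel (a x : ℝ) : ℝ≥0∞ :=
  ENNReal.ofReal (if 0 < x then x ^ (a - 1) else 0)

@[fun_prop]
lemma measurable_powKernel (a : ℝ) : Measurable (powKernel a) :=
  (Measurable.ite measurableSet_Ioi (by fun_prop) measurable_const).ennreal_ofReal

lemma powKernel_of_pos (a : ℝ) {x : ℝ} (hx : 0 < x) :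
    powKernel a x = ENNReal.ofReal (x ^ (a - 1)) := by
  simp [powKernel, hx]

lemma powKernel_of_nonpos (a : ℝ) {x : ℝ} (hx : x ≤ 0) : powKernel a x = 0 := by
  simp [powKernel, hx.not_gt]

lemma powKernel_mul {a s : ℝ} (hs : 0 < s) (x : ℝ) :
    powKernel a (s * x) = ENNReal.ofReal (s ^ (a - 1)) * powKernel a x := by
  rcases le_or_gt x 0 with hx | hx
  · rw [powKernel_of_nonpos a hx, powKernel_of_nonpos a (mul_nonpos_of_nonneg_of_nonpos hs.le hx),
      mul_zero]
  · rw [powKernel_of_pos a hx, powKernel_of_pos a (mul_pos hs hx), mul_rpow hs.le hx.le,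
      ENNReal.ofReal_mul (by positivity)]

lemma powKernel_mul_powKernel_one_sub {a b : ℝ} (ha : 0 < a) (hb : 0 < b) (x : ℝ) :
    powKernel a x * powKernel b (1 - x)
      = ENNReal.ofReal (beta a b) * ProbabilityTheory.betaPDF a b x := by
  rcases le_or_gt x 0 with hx | hx
  · rw [powKernel_of_nonpos a hx, ProbabilityTheory.betaPDF_eq_zero_of_nonpos hx]; simp
  rcases le_or_gt 1 x with hx1 | hx1
  · rw [powKernel_of_nonpos b (by linarith : 1 - x ≤ 0),
      ProbabilityTheory.betaPDF_eq_zero_of_one_le hx1]; simp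
  have hβ := ProbabilityTheory.beta_pos ha hb
  rw [powKernel_of_pos a hx, powKernel_of_pos b (by linarith : 0 < 1 - x),
    ProbabilityTheory.betaPDF_of_pos_lt_one hx hx1, ← ENNReal.ofReal_mul (by positivity),
    ← ENNReal.ofReal_mul hβ.le]
  congr 1
  field_simp

/-- The power kernels form a convolution semigroup up to Beta factors. -/
lemma lintegral_powKernel_mul_powKernel_sub {a b : ℝ} (ha : 0 < a) (hb : 0 < b) (s : ℝ) :
    ∫⁻ y, powKernel a y * powKernel b (s - y)
      = ENNReal.ofReal (beta a b) * powKernel (a + b) s := by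
  rcases le_or_gt s 0 with hs | hs
  · rw [powKernel_of_nonpos _ hs, mul_zero]
    refine lintegral_eq_zero_of_ae_eq_zero (.of_forall fun y => ?_)
    rcases le_or_gt y 0 with hy | hy
    · simp [powKernel_of_nonpos a hy]
    · simp [powKernel_of_nonpos b (by linarith : s - y ≤ 0)]
  have hmeas : Measurable fun y => powKernel a y * powKernel b (s - y) := by fun_prop
  have hvol : (volume : Measure ℝ) = ENNReal.ofReal s • Measure.map (s * ·) volume := by
    simpa only [abs_of_pos hs] using (Real.smul_map_volume_mul_left hs.ne').symm
  rw [hvol, lintegral_smul_measure, lintegral_map hmeas (by fun_prop)]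
  have hpt (u : ℝ) : powKernel a (s * u) * powKernel b (s - s * u)
      = ENNReal.ofReal (s ^ (a - 1) * s ^ (b - 1) * beta a b)
        * ProbabilityTheory.betaPDF a b u := by
    rw [show s - s * u = s * (1 - u) by ring, powKernel_mul hs, powKernel_mul hs, mul_mul_mul_comm,
      powKernel_mul_powKernel_one_sub ha hb, ← ENNReal.ofReal_mul (by positivity), ← mul_assoc,
      ← ENNReal.ofReal_mul (by positivity)]
  have hβ := ProbabilityTheory.beta_pos ha hb
  simp_rw [hpt]
  rw [lintegral_const_mul' _ _ ENNReal.ofReal_ne_top,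
    ProbabilityTheory.lintegral_betaPDF_eq_one ha hb, mul_one, powKernel_of_pos _ hs, smul_eq_mul,
    ← ENNReal.ofReal_mul hs.le, ← ENNReal.ofReal_mul hβ.le]
  congr 1
  rw [show a + b - 1 = 1 + (a - 1) + (b - 1) by ring, rpow_add hs, rpow_add hs, rpow_one]
  ring

/-- The Dirichlet integral over a simplex of arbitrary size. -/
lemma lintegral_prod_powKernel (n : ℕ) (a : Fin n → ℝ) (ha : ∀ j, 0 < a j) {b : ℝ} (hb : 0 < b)
    (s : ℝ) :
    ∫⁻ x : Fin n → ℝ, (∏ j, powKernel (a j) (x j)) * powKernel b (s - ∑ j, x j)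
      = ENNReal.ofReal ((∏ j, Gamma (a j)) * Gamma b / Gamma (∑ j, a j + b))
        * powKernel (∑ j, a j + b) s := by
  induction n generalizing s with
  | zero => simp [(Gamma_pos_of_pos hb).ne', volume_pi]
  | succ n ih =>
    have hc : 0 < ∑ j : Fin n, a j.succ + b :=
      add_pos_of_nonneg_of_pos (sum_nonneg fun j _ => (ha _).le) hb
    have hΓ (j) : 0 < Gamma (a j) := Gamma_pos_of_pos (ha j)
    have hΓc := Gamma_pos_of_pos hc
    have hΓb := Gamma_pos_of_pos hb
    have hP : 0 < ∏ j : Fin n, Gamma (a j.succ) := prod_pos fun j _ => hΓ _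
    rw [← ((volume_preserving_piFinSuccAbove (fun _ => ℝ) 0).symm).lintegral_comp (by fun_prop),
      Measure.volume_eq_prod, lintegral_prod _ (by
        apply Measurable.aemeasurable
        refine Measurable.comp (g := fun x : Fin (n + 1) → ℝ =>
          (∏ j, powKernel (a j) (x j)) * powKernel b (s - ∑ j, x j)) (by fun_prop) ?_
        exact MeasurableEquiv.measurable _)]
    simp only [MeasurableEquiv.piFinSuccAbove_symm_apply, Fin.insertNthEquiv, Equiv.coe_fn_mk,
      Fin.insertNth_zero', Fin.prod_univ_succ, Fin.sum_univ_succ, Fin.cons_zero, Fin.cons_succ]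
    simp_rw [mul_assoc (powKernel (a 0) _), ← sub_sub]
    have hinner (y : ℝ) := ih (fun j => a j.succ) (fun j => ha _) (s - y)
    have hconst (y : ℝ) : powKernel (a 0) y ≠ ∞ := ENNReal.ofReal_ne_top
    simp_rw [lintegral_const_mul' _ _ (hconst _), hinner,
      mul_left_comm (powKernel (a 0) _) (ENNReal.ofReal _)]
    rw [lintegral_const_mul' _ _ ENNReal.ofReal_ne_top,
      lintegral_powKernel_mul_powKernel_sub (ha 0) hc, ← mul_assoc,
      ← ENNReal.ofReal_mul (by positivity), add_assoc]
    congr 2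
    rw [beta]
    field_simp

/-- The unnormalised Dirichlet measure on the solid simplex. -/
noncomputable def dirichletMeasure (A : ℕ) (β : Fin A → ℝ) : Measure (Fin (A - 1) → ℝ) :=
  volume.withDensity fun x => ∏ j, powKernel (β j) (simplexCoord A x j)

@[fun_prop]
lemma measurable_simplexCoord (A : ℕ) (j : Fin A) : Measurable fun x => simplexCoord A x j := by
  unfold simplexCoord
  split_ifs <;> fun_prop

lemma measurable_prod_powKernel_simplexCoord (A : ℕ) (β : Fin A → ℝ) :
    Measurable fun x => ∏ j, powKernel (β j) (simplexCoord A x j) := by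
  fun_prop

lemma lintegral_prod_powKernel_simplexCoord {A : ℕ} (hA : 1 ≤ A) {β : Fin A → ℝ}
    (hβ : ∀ j, 0 < β j) :
    ∫⁻ x, ∏ j, powKernel (β j) (simplexCoord A x j)
      = ENNReal.ofReal ((∏ j, Gamma (β j)) / Gamma (∑ j, β j)) := by
  obtain ⟨n, rfl⟩ := Nat.exists_eq_add_of_le' hA
  have h := lintegral_prod_powKernel n (fun j => β j.castSucc) (fun j => hβ _) (hβ (Fin.last n)) 1
  rw [powKernel_of_pos _ one_pos, one_rpow, ENNReal.ofReal_one, mul_one,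
    ← Fin.prod_univ_castSucc (fun j => Gamma (β j)), ← Fin.sum_univ_castSucc] at h
  rw [← h]
  refine lintegral_congr fun x => ?_
  rw [Fin.prod_univ_castSucc]
  simp [simplexCoord]

lemma powKernel_mul_exp_log (a c x : ℝ) :
    powKernel a x * ENNReal.ofReal (exp (c * log x)) = powKernel (a + c) x := by
  rcases le_or_gt x 0 with hx | hx
  · simp [powKernel_of_nonpos _ hx]
  · rw [powKernel_of_pos _ hx, powKernel_of_pos _ hx, ← ENNReal.ofReal_mul (by positivity),
      mul_comm c, ← rpow_def_of_pos hx, ← rpow_add hx, add_sub_right_comm]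

lemma lintegral_exp_dirichletMeasure {A : ℕ} (hA : 1 ≤ A) {β v : Fin A → ℝ} {t : ℝ}
    (h : ∀ j, 0 < β j + t * v j) :
    ∫⁻ x, ENNReal.ofReal (exp (t * ∑ j, v j * log (simplexCoord A x j))) ∂dirichletMeasure A β
      = ENNReal.ofReal ((∏ j, Gamma (β j + t * v j)) / Gamma (∑ j, (β j + t * v j))) := by
  rw [dirichletMeasure, lintegral_withDensity_eq_lintegral_mul _
    (measurable_prod_powKernel_simplexCoord A β) (by fun_prop),
    ← lintegral_prod_powKernel_simplexCoord hA h]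
  refine lintegral_congr fun x => ?_
  simp_rw [Pi.mul_apply, mul_sum, exp_sum, ENNReal.ofReal_prod_of_nonneg fun _ _ => (exp_pos _).le,
    ← prod_mul_distrib, ← mul_assoc, powKernel_mul_exp_log]

lemma integrable_exp_dirichletMeasure {A : ℕ} (hA : 1 ≤ A) {β v : Fin A → ℝ} {t : ℝ}
    (h : ∀ j, 0 < β j + t * v j) :
    Integrable (fun x => exp (t * ∑ j, v j * log (simplexCoord A x j))) (dirichletMeasure A β) := by
  refine ⟨(Measurable.aestronglyMeasurable (by fun_prop)), ?_⟩
  rw [hasFiniteIntegral_iff_ofReal (.of_forall fun _ => (exp_pos _).le),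
    lintegral_exp_dirichletMeasure hA h]
  exact ENNReal.ofReal_lt_top

lemma mgf_dirichletMeasure {A : ℕ} (hA : 1 ≤ A) {β v : Fin A → ℝ} {t : ℝ}
    (h : ∀ j, 0 < β j + t * v j) :
    ProbabilityTheory.mgf (fun x => ∑ j, v j * log (simplexCoord A x j)) (dirichletMeasure A β) t
      = (∏ j, Gamma (β j + t * v j)) / Gamma (∑ j, (β j + t * v j)) := by
  rw [ProbabilityTheory.mgf, integral_eq_lintegral_of_nonneg_ae
    (.of_forall fun _ => (exp_pos _).le) (Measurable.aestronglyMeasurable (by fun_prop)),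
    lintegral_exp_dirichletMeasure hA h, ENNReal.toReal_ofReal]
  exact div_nonneg (prod_nonneg fun j _ => (Gamma_pos_of_pos (h j)).le)
    (Gamma_nonneg_of_nonneg (sum_nonneg fun j _ => (h j).le))

lemma eventually_forall_pos_add_mul {A : ℕ} {β : Fin A → ℝ} (hβ : ∀ j, 0 < β j) (v : Fin A → ℝ) :
    ∀ᶠ t in nhds (0 : ℝ), ∀ j, 0 < β j + t * v j := by
  rw [Filter.eventually_all]
  intro j
  have hc : ContinuousAt (fun t : ℝ => β j + t * v j) 0 := by fun_prop
  exact hc.eventually_const_lt (by simpa using hβ j)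

lemma zero_mem_interior_integrableExpSet_dirichletMeasure {A : ℕ} (hA : 1 ≤ A) {β : Fin A → ℝ}
    (hβ : ∀ j, 0 < β j) (v : Fin A → ℝ) :
    0 ∈ interior (ProbabilityTheory.integrableExpSet
      (fun x => ∑ j, v j * log (simplexCoord A x j)) (dirichletMeasure A β)) := by
  rw [mem_interior_iff_mem_nhds]
  filter_upwards [eventually_forall_pos_add_mul hβ v] with t ht
  exact integrable_exp_dirichletMeasure hA ht

lemma analyticAt_Gamma_of_pos {x : ℝ} (hx : 0 < x) : AnalyticAt ℝ Gamma x := by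
  have hd : DifferentiableOn ℂ Complex.Gamma {z | 0 < z.re} := fun z hz =>
    (Complex.differentiableAt_Gamma z fun m hm => by
      have : (0 : ℝ) < z.re := hz
      rw [hm] at this
      simp at this
      linarith [(Nat.cast_nonneg m : (0 : ℝ) ≤ m)]).differentiableWithinAt
  have ho : IsOpen {z : ℂ | 0 < z.re} := isOpen_lt continuous_const Complex.continuous_re
  have ha : AnalyticAt ℂ Complex.Gamma x :=
    hd.analyticAt (ho.mem_nhds (by simpa using hx))
  exact (ha.contDiffAt (n := ⊤)).real_of_complex.analyticAt

lemma analyticAt_log_Gamma_of_pos {x : ℝ} (hx : 0 < x) :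
    AnalyticAt ℝ (fun y => log (Gamma y)) x :=
  (analyticAt_Gamma_of_pos hx).log (Gamma_pos_of_pos hx)

lemma hasDerivAt_log_Gamma {x : ℝ} (hx : 0 < x) :
    HasDerivAt (fun y => log (Gamma y)) (digamma x) x :=
  (analyticAt_log_Gamma_of_pos hx).differentiableAt.hasDerivAt

lemma hasDerivAt_digamma {x : ℝ} (hx : 0 < x) : HasDerivAt digamma (trigamma x) x :=
  (analyticAt_log_Gamma_of_pos hx).deriv.differentiableAt.hasDerivAt

/-- The second moment of a linear combination of the log-coordinates under the unnormalised
Dirichlet measure. -/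
lemma integral_sq_dirichletMeasure {A : ℕ} (hA : 1 ≤ A) {β : Fin A → ℝ}
    (hβ : ∀ j, 0 < β j) (v : Fin A → ℝ) :
    ∫ x, (∑ j, v j * log (simplexCoord A x j)) ^ 2 ∂dirichletMeasure A β
      = (∏ j, Gamma (β j)) / Gamma (∑ j, β j) *
        ((∑ j, v j * digamma (β j) - (∑ j, v j) * digamma (∑ j, β j)) ^ 2
          + (∑ j, v j ^ 2 * trigamma (β j) - (∑ j, v j) ^ 2 * trigamma (∑ j, β j))) := by
  have : Nonempty (Fin A) := ⟨⟨0, hA⟩⟩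
  have hpos {t : ℝ} (h : ∀ j, 0 < β j + t * v j) : 0 < ∑ j, (β j + t * v j) :=
    sum_pos (fun j _ => h j) univ_nonempty
  have hβ0 : ∀ j, 0 < β j + 0 * v j := by simpa using hβ
  have hlin (b c t : ℝ) : HasDerivAt (fun t : ℝ => b + t * c) c t := by
    simpa using ((hasDerivAt_id t).mul_const c).const_add b
  have hlinsum (t : ℝ) : HasDerivAt (fun t : ℝ => ∑ j, (β j + t * v j)) (∑ j, v j) t :=
    HasDerivAt.fun_sum fun j _ => hlin _ _ _
  have hmem := zero_mem_interior_integrableExpSet_dirichletMeasure hA hβ v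
  set X : (Fin (A - 1) → ℝ) → ℝ := fun x => ∑ j, v j * log (simplexCoord A x j) with hX
  set μ := dirichletMeasure A β
  have hcgf : ∀ᶠ t in nhds (0 : ℝ), ProbabilityTheory.cgf X μ t
      = ∑ j, log (Gamma (β j + t * v j)) - log (Gamma (∑ j, (β j + t * v j))) := by
    filter_upwards [eventually_forall_pos_add_mul hβ v] with t ht
    rw [ProbabilityTheory.cgf, mgf_dirichletMeasure hA ht, log_div
      (prod_pos fun j _ => Gamma_pos_of_pos (ht j)).ne' (Gamma_pos_of_pos (hpos ht)).ne',
      log_prod fun j _ => (Gamma_pos_of_pos (ht j)).ne']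
  have hderiv : deriv (ProbabilityTheory.cgf X μ) =ᶠ[nhds 0] fun t =>
      ∑ j, digamma (β j + t * v j) * v j - digamma (∑ j, (β j + t * v j)) * ∑ j, v j := by
    filter_upwards [hcgf.eventually_nhds, eventually_forall_pos_add_mul hβ v] with t ht hp
    rw [Filter.EventuallyEq.deriv_eq ht]
    exact ((HasDerivAt.fun_sum fun j _ => (hasDerivAt_log_Gamma (hp j)).comp t (hlin _ _ _)).sub
      ((hasDerivAt_log_Gamma (hpos hp)).comp t (hlinsum t))).deriv
  have hderiv2 : iteratedDeriv 2 (ProbabilityTheory.cgf X μ) 0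
      = ∑ j, trigamma (β j) * v j * v j - trigamma (∑ j, β j) * (∑ j, v j) * ∑ j, v j := by
    rw [iteratedDeriv_succ, iteratedDeriv_one, hderiv.deriv_eq]
    have h := ((HasDerivAt.fun_sum (u := univ) fun j _ =>
      ((hasDerivAt_digamma (hβ0 j)).comp 0 (hlin _ _ _)).mul_const (v j)).fun_sub
      (((hasDerivAt_digamma (hpos hβ0)).comp 0 (hlinsum 0)).mul_const (∑ j, v j))).deriv
    simpa using h
  have hmgf : ProbabilityTheory.mgf X μ 0 = (∏ j, Gamma (β j)) / Gamma (∑ j, β j) := by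
    simpa using mgf_dirichletMeasure hA hβ0
  have hD : 0 < (∏ j, Gamma (β j)) / Gamma (∑ j, β j) :=
    div_pos (prod_pos fun j _ => Gamma_pos_of_pos (hβ j))
      (Gamma_pos_of_pos (sum_pos (fun j _ => hβ j) univ_nonempty))
  have key := ProbabilityTheory.iteratedDeriv_two_cgf hmem
  rw [hderiv2, hderiv.eq_of_nhds, hmgf] at key
  simp only [zero_mul, add_zero, exp_zero, mul_one] at key
  rw [eq_sub_iff_add_eq, eq_div_iff hD.ne'] at key
  rw [← key]
  simp only [mul_comm (digamma _), mul_comm (trigamma _), mul_assoc, sq]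
  ring_nf

/-- The mixed second moment of two distinct log-coordinates under the unnormalised Dirichlet
measure. -/
lemma integral_log_mul_log_dirichletMeasure {A : ℕ} {β : Fin A → ℝ} (hβ : ∀ j, 0 < β j)
    {i k : Fin A} (hik : i ≠ k) :
    ∫ x, log (simplexCoord A x i) * log (simplexCoord A x k) ∂dirichletMeasure A β
      = (∏ j, Gamma (β j)) / Gamma (∑ j, β j) *
        ((digamma (β i) - digamma (∑ j, β j)) * (digamma (β k) - digamma (∑ j, β j))
          - trigamma (∑ j, β j)) := by
  have hA : 1 ≤ A := i.pos
  have hsqInt (v : Fin A → ℝ) := ProbabilityTheory.integrable_pow_of_mem_interior_integrableExpSet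
    (zero_mem_interior_integrableExpSet_dirichletMeasure hA hβ v) 2
  have hsingle (l : Fin A) (f : Fin A → ℝ) : ∑ j, (Pi.single l 1 : Fin A → ℝ) j * f j = f l := by
    simp [Pi.single_apply]
  have hsq (l : Fin A) (f : Fin A → ℝ) : ∑ j, (Pi.single l 1 : Fin A → ℝ) j ^ 2 * f j = f l := by
    simp [Pi.single_apply]
  have hone (l : Fin A) : ∑ j, (Pi.single l (1 : ℝ) : Fin A → ℝ) j = 1 := by simp
  have hadd (f : Fin A → ℝ) :
      ∑ j, (Pi.single i (1 : ℝ) + Pi.single k 1 : Fin A → ℝ) j * f j = f i + f k := by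
    simp_rw [Pi.add_apply, add_mul, sum_add_distrib, hsingle]
  have haddsq (f : Fin A → ℝ) :
      ∑ j, (Pi.single i (1 : ℝ) + Pi.single k 1 : Fin A → ℝ) j ^ 2 * f j = f i + f k := by
    rw [← hsq i f, ← hsq k f, ← sum_add_distrib]
    refine sum_congr rfl fun j _ => ?_
    rcases eq_or_ne j i with rfl | hj
    · simp [hik]
    · simp [hj]
  have haddone : ∑ j, (Pi.single i (1 : ℝ) + Pi.single k 1 : Fin A → ℝ) j = 2 := by
    simp_rw [Pi.add_apply, sum_add_distrib, hone]
    norm_num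
  have hi := integral_sq_dirichletMeasure hA hβ (Pi.single i 1)
  have hk := integral_sq_dirichletMeasure hA hβ (Pi.single k 1)
  have hs := integral_sq_dirichletMeasure hA hβ (Pi.single i 1 + Pi.single k 1)
  have hInt_i := hsqInt (Pi.single i 1)
  have hInt_k := hsqInt (Pi.single k 1)
  have hInt_s := hsqInt (Pi.single i 1 + Pi.single k 1)
  simp only [hsingle, hsq, hone] at hi hk hInt_i hInt_k
  simp only [hadd, haddsq, haddone] at hs hInt_s
  have hpolar (x : Fin (A - 1) → ℝ) : log (simplexCoord A x i) * log (simplexCoord A x k)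
      = 2⁻¹ * ((log (simplexCoord A x i) + log (simplexCoord A x k)) ^ 2
          - log (simplexCoord A x i) ^ 2 - log (simplexCoord A x k) ^ 2) := by ring
  have hInt_sub : Integrable (fun x => (log (simplexCoord A x i) + log (simplexCoord A x k)) ^ 2
      - log (simplexCoord A x i) ^ 2) (dirichletMeasure A β) := hInt_s.sub hInt_i
  simp_rw [hpolar]
  rw [integral_const_mul, integral_sub hInt_sub hInt_k, integral_sub hInt_s hInt_i,
    hi, hk, hs]
  ring

lemma ae_simplexCoord_ne_zero (A : ℕ) (j : Fin A) :
    ∀ᵐ x : Fin (A - 1) → ℝ, simplexCoord A x j ≠ 0 := by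
  let S : AffineSubspace ℝ (Fin (A - 1) → ℝ) :=
    { carrier := {x | simplexCoord A x j = 0}
      smul_vsub_vadd_mem' := by
        intro c p q r hp hq hr
        have : simplexCoord A (c • (p -ᵥ q) +ᵥ r) j
            = c * (simplexCoord A p j - simplexCoord A q j) + simplexCoord A r j := by
          unfold simplexCoord
          split_ifs
          · simp
          · simp [sum_add_distrib, ← mul_sum]
            ring
        simp_all }
  have hS : ∀ᵐ x, x ∉ (S : Set (Fin (A - 1) → ℝ)) := by
    refine measure_eq_zero_iff_ae_notMem.1 (Measure.addHaar_affineSubspace volume S fun h => ?_)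
    have hmem (x : Fin (A - 1) → ℝ) : simplexCoord A x j = 0 :=
      (h ▸ AffineSubspace.mem_top ℝ _ x : x ∈ S)
    by_cases hj : (j : ℕ) < A - 1
    · simpa [simplexCoord, hj] using hmem 1
    · simpa [simplexCoord, hj] using hmem 0
  exact hS

lemma mem_solidSimplex_iff {A : ℕ} (hA : 1 ≤ A) {x : Fin (A - 1) → ℝ} :
    x ∈ solidSimplex A ↔ ∀ j, 0 ≤ simplexCoord A x j := by
  obtain ⟨n, rfl⟩ := Nat.exists_eq_add_of_le' hA
  rw [Fin.forall_fin_succ']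
  simp [solidSimplex, simplexCoord]

lemma measurableSet_solidSimplex {A : ℕ} (hA : 1 ≤ A) : MeasurableSet (solidSimplex A) := by
  have : solidSimplex A = ⋂ j, {x | 0 ≤ simplexCoord A x j} := by
    ext x
    simp [mem_solidSimplex_iff hA]
  rw [this]
  exact .iInter fun j => measurableSet_le measurable_const (measurable_simplexCoord A j)

lemma setIntegral_solidSimplex_eq_integral_dirichletMeasure {A : ℕ} (hA : 1 ≤ A) (β : Fin A → ℝ)
    (f : (Fin (A - 1) → ℝ) → ℝ) :
    ∫ x in solidSimplex A, (∏ j, simplexCoord A x j ^ (β j - 1)) * f x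
      = ∫ x, f x ∂dirichletMeasure A β := by
  rw [dirichletMeasure, integral_withDensity_eq_integral_toReal_smul
    (measurable_prod_powKernel_simplexCoord A β)
    (.of_forall fun x => ENNReal.prod_lt_top fun j _ => ENNReal.ofReal_lt_top),
    ← integral_indicator (measurableSet_solidSimplex hA)]
  refine integral_congr_ae ?_
  filter_upwards [ae_all_iff.2 (ae_simplexCoord_ne_zero A)] with x hx
  by_cases hmem : x ∈ solidSimplex A
  · have hpos (j) : 0 < simplexCoord A x j :=
      ((mem_solidSimplex_iff hA).1 hmem j).lt_of_ne' (hx j)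
    rw [Set.indicator_of_mem hmem, ENNReal.toReal_prod, smul_eq_mul]
    congr 1
    refine prod_congr rfl fun j _ => ?_
    rw [powKernel_of_pos _ (hpos j), ENNReal.toReal_ofReal (rpow_nonneg (hpos j).le _)]
  · rw [Set.indicator_of_notMem hmem]
    rw [mem_solidSimplex_iff hA] at hmem
    push Not at hmem
    obtain ⟨j, hj⟩ := hmem
    rw [prod_eq_zero (mem_univ j) (powKernel_of_nonpos _ hj.le)]
    simp

/-- The Dirichlet cross term: for `i ≠ k`,
`∫_{T_A} (πᵢ log πᵢ)(πₖ log πₖ) ∏ⱼ πⱼ^{αⱼ−1} dx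
 = (∏ⱼ Γ(αⱼ)/Γ(Ā)) (αᵢαₖ/((Ā+1)Ā)) [(ψ₀(αᵢ+1) − ψ₀(Ā+2))(ψ₀(αₖ+1) − ψ₀(Ā+2)) − ψ₁(Ā+2)]`. -/
theorem dirichlet_entropy_cross_term (A : ℕ) (hA : 2 ≤ A) (α : Fin A → ℝ)
    (hα : ∀ i, 0 < α i) (i k : Fin A) (hik : i ≠ k) :
    ∫ x in solidSimplex A,
        (simplexCoord A x i * Real.log (simplexCoord A x i)) *
          (simplexCoord A x k * Real.log (simplexCoord A x k)) *
          ∏ j, simplexCoord A x j ^ (α j - 1)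
      = ((∏ j, Real.Gamma (α j)) / Real.Gamma (∑ j, α j)) *
          (α i * α k / (((∑ j, α j) + 1) * (∑ j, α j))) *
          ((digamma (α i + 1) - digamma ((∑ j, α j) + 2)) *
              (digamma (α k + 1) - digamma ((∑ j, α j) + 2))
            - trigamma ((∑ j, α j) + 2)) := by
  have hA1 : 1 ≤ A := by omega
  set β : Fin A → ℝ := fun j => α j + (if j = i then 1 else 0) + (if j = k then 1 else 0) with hβdef
  have hβ (j) : 0 < β j := by
    have := hα j
    positivity
  have hS : 0 < ∑ j, α j := sum_pos (fun j _ => hα j) ⟨i, mem_univ i⟩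
  have hβsum : ∑ j, β j = ∑ j, α j + 2 := by
    simp only [hβdef, sum_add_distrib, sum_ite_eq', mem_univ, if_true]
    ring
  have hβi : β i = α i + 1 := by simp [hβdef, hik]
  have hβk : β k = α k + 1 := by simp [hβdef, hik.symm]
  have hΓprod : ∏ j, Gamma (β j) = (∏ j, Gamma (α j)) * α i * α k := by
    have hΓ (j) : Gamma (β j)
        = Gamma (α j) * (if j = i then α j else 1) * (if j = k then α j else 1) := by
      rcases eq_or_ne j i with rfl | hji
      · simp [hβdef, hik, Gamma_add_one (hα _).ne', mul_comm]
      · rcases eq_or_ne j k with rfl | hjk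
        · simp [hβdef, hji, Gamma_add_one (hα _).ne', mul_comm]
        · simp [hβdef, hji, hjk]
    simp only [hΓ, prod_mul_distrib, prod_ite_eq', mem_univ, if_true]
  have hΓsum : Gamma (∑ j, α j + 2) = (∑ j, α j + 1) * (∑ j, α j) * Gamma (∑ j, α j) := by
    rw [show ∑ j, α j + 2 = ∑ j, α j + 1 + 1 by ring, Gamma_add_one (by positivity),
      Gamma_add_one hS.ne', mul_assoc]
  have hintegrand : ∀ᵐ x ∂volume.restrict (solidSimplex A),
      (simplexCoord A x i * Real.log (simplexCoord A x i)) *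
          (simplexCoord A x k * Real.log (simplexCoord A x k)) *
          ∏ j, simplexCoord A x j ^ (α j - 1)
        = (∏ j, simplexCoord A x j ^ (β j - 1)) *
          (log (simplexCoord A x i) * log (simplexCoord A x k)) := by
    filter_upwards [ae_restrict_of_ae (ae_all_iff.2 (ae_simplexCoord_ne_zero A))] with x hx
    have hpow (j) : simplexCoord A x j ^ (β j - 1) = simplexCoord A x j ^ (α j - 1)
        * (if j = i then simplexCoord A x j else 1)
        * (if j = k then simplexCoord A x j else 1) := by
      rcases eq_or_ne j i with rfl | hji
      · simp [hβdef, hik, ← rpow_add_one (hx _)]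
      · rcases eq_or_ne j k with rfl | hjk
        · simp [hβdef, hji, ← rpow_add_one (hx _)]
        · simp [hβdef, hji, hjk]
    simp only [hpow, prod_mul_distrib, prod_ite_eq', mem_univ, if_true]
    ring
  rw [integral_congr_ae hintegrand, setIntegral_solidSimplex_eq_integral_dirichletMeasure hA1,
    integral_log_mul_log_dirichletMeasure hβ hik, hβsum, hβi, hβk, hΓprod, hΓsum]
  field_simp
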